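/- arXiv:1203.4295 — 3 statements merged into one kernel-verified Lean document; each statement's English description precedes it below -/
import Mathlib

section
/- Let α be irrational with 0 < α < 1, let 0 ≤ β < 1 have Davenport coefficients (b_i), and let n ≥ 1. Then Q_n ≥ q_n − q_{n−1} if and only if there exists an index m with 1 ≤ m ≤ n such that (b_m, b_{m+1}, …, b_n) = (a_m − 1, a_{m+1} − 2, a_{m+2} − 2, …, a_n − 2) (for m = n this means b_n = a_n − 1). -/
open Filter Finset

/-- Distance from `x` to the nearest integer. -/
noncomputable def nint (x : ℝ) : ℝ := |x - (round x : ℝ)|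

/-- One-sided inhomogeneous approximation constant
`M₊(α,β) = liminf_{q→∞} q‖qα−β‖` over positive integers `q`. -/
noncomputable def Mplus (α β : ℝ) : ℝ :=
  Filter.liminf (fun q : ℕ => (q : ℝ) * nint (q * α - β)) Filter.atTop

/-- Complete quotients of the negative continued fraction: `ncq α i = α_{i+1}`,
so `ncq α 0 = α₁ = α` and `α_{i+1} = a_i - 1/α_i` with `a_i = ⌈1/α_i⌉`. -/
noncomputable def ncq (α : ℝ) : ℕ → ℝ
  | 0 => α
  | i + 1 => (⌈(ncq α i)⁻¹⌉ : ℝ) - (ncq α i)⁻¹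

/-- Partial quotients of the negative continued fraction: `npq α i = a_i = ⌈1/α_i⌉` for `i ≥ 1`. -/
noncomputable def npq (α : ℝ) (i : ℕ) : ℤ := ⌈(ncq α (i - 1))⁻¹⌉

/-- Convergent denominators: `q₀ = 1`, `q₁ = a₁`, `q_{i+2} = a_{i+2} q_{i+1} − q_i`. -/
noncomputable def nq (α : ℝ) : ℕ → ℤ
  | 0 => 1
  | 1 => npq α 1
  | i + 2 => npq α (i + 2) * nq α (i + 1) - nq α i

/-- Convergent numerators: `p₀ = 0`, `p₁ = 1`, `p_{i+2} = a_{i+2} p_{i+1} − p_i`. -/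
noncomputable def np (α : ℝ) : ℕ → ℤ
  | 0 => 0
  | 1 => 1
  | i + 2 => npq α (i + 2) * np α (i + 1) - np α i

/-- `Dk α k = α₁α₂⋯α_k` (with `Dk α 0 = 1`). -/
noncomputable def Dk (α : ℝ) (k : ℕ) : ℝ := ∏ j ∈ Finset.range k, ncq α j

/-- Davenport remainders: `drem α β i = β_{i+1}`, so `drem α β 0 = β₁ = β` and
`β_{i+1} = β_i/α_i − ⌊β_i/α_i⌋`. -/
noncomputable def drem (α β : ℝ) : ℕ → ℝ
  | 0 => β
  | i + 1 => Int.fract (drem α β i / ncq α i)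

/-- Davenport coefficients: `db α β i = b_i = ⌊β_i/α_i⌋` for `i ≥ 1`. -/
noncomputable def db (α β : ℝ) (i : ℕ) : ℤ := ⌊drem α β (i - 1) / ncq α (i - 1)⌋

/-- `Qn α β n = Σ_{k=1}^n b_k q_{k−1}`. -/
noncomputable def Qn (α β : ℝ) (n : ℕ) : ℤ :=
  ∑ k ∈ Finset.Icc 1 n, db α β k * nq α (k - 1)

/-- `Q′_n`. -/
noncomputable def Qn' (α β : ℝ) (n : ℕ) : ℤ :=
  if Qn α β n < nq α n - nq α (n - 1) then Qn α β n + nq α (n - 1)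
  else Qn α β n + nq α (n - 1) - nq α n

/-- `λ_n(β) = Q_n D_n β_{n+1}`. -/
noncomputable def lam (α β : ℝ) (n : ℕ) : ℝ :=
  (Qn α β n : ℝ) * Dk α n * drem α β n

/-- `ρ_n(β)`. -/
noncomputable def rho (α β : ℝ) (n : ℕ) : ℝ :=
  if Qn α β n < nq α n - nq α (n - 1)
  then (Qn' α β n : ℝ) * Dk α n * (1 - drem α β n)
  else (Qn' α β n : ℝ) * Dk α n * (1 - ncq α n - drem α β n)

/-- Reversed quotients: `ᾱ₀ = 0`, `ᾱ_i = 1/(a_i − ᾱ_{i−1})`. -/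
noncomputable def rq (α : ℝ) : ℕ → ℝ
  | 0 => 0
  | i + 1 => ((npq α (i + 1) : ℝ) - rq α i)⁻¹

/-- The denominator preceding `nq α n`, with the convention `q₋₁ = 0`. -/
noncomputable def nqPrev (α : ℝ) : ℕ → ℤ
  | 0 => 0
  | n + 1 => nq α n

/-- The coefficients up to index `n` end in a block
`(a_m − 1, a_{m+1} − 2, …, a_n − 2)`. -/
def HasMaximalTail (α β : ℝ) (n : ℕ) : Prop :=
  ∃ m : ℕ, 1 ≤ m ∧ m ≤ n ∧ db α β m = npq α m - 1 ∧
    ∀ k : ℕ, m < k → k ≤ n → db α β k = npq α k - 2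

theorem not_hasMaximalTail_zero (α β : ℝ) : ¬ HasMaximalTail α β 0 := by
  rintro ⟨m, h1, h2, -⟩
  omega

theorem hasMaximalTail_succ (α β : ℝ) (n : ℕ) :
    HasMaximalTail α β (n + 1) ↔ db α β (n + 1) = npq α (n + 1) - 1 ∨
      (db α β (n + 1) = npq α (n + 1) - 2 ∧ HasMaximalTail α β n) := by
  constructor
  · rintro ⟨m, hm1, hmn, hm, hk⟩
    rcases hmn.eq_or_lt with rfl | hlt
    · exact Or.inl hm
    · exact Or.inr ⟨hk _ hlt le_rfl, m, hm1, by omega, hm, fun k h h' => hk k h (by omega)⟩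
  · rintro (h | ⟨h, m, hm1, hmn, hm, hk⟩)
    · exact ⟨n + 1, by omega, le_rfl, h, fun k h h' => by omega⟩
    · refine ⟨m, hm1, by omega, hm, fun k h1 h2 => ?_⟩
      rcases h2.eq_or_lt with rfl | hlt
      · exact h
      · exact hk k h1 (by omega)

theorem nq_succ (α : ℝ) (n : ℕ) :
    nq α (n + 1) = npq α (n + 1) * nq α n - nqPrev α n := by
  cases n <;> simp [nq, nqPrev]

theorem ncq_succ (α : ℝ) (n : ℕ) : ncq α (n + 1) = npq α (n + 1) - (ncq α n)⁻¹ := rfl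

theorem ncq_irrational_mem (α : ℝ) (hirr : Irrational α) (h0 : 0 < α) (h1 : α < 1) (n : ℕ) :
    Irrational (ncq α n) ∧ 0 < ncq α n ∧ ncq α n < 1 := by
  induction n with
  | zero => exact ⟨hirr, h0, h1⟩
  | succ n ih =>
    have hi : Irrational (ncq α (n + 1)) := by
      rw [ncq_succ]
      exact ih.1.inv.intCast_sub _
    refine ⟨hi, lt_of_le_of_ne ?_ hi.ne_zero.symm, ?_⟩
    · have := Int.le_ceil (ncq α n)⁻¹
      simp only [ncq]
      linarith
    · have := Int.ceil_lt_add_one (ncq α n)⁻¹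
      simp only [ncq]
      linarith

theorem two_le_npq_succ (α : ℝ) (hirr : Irrational α) (h0 : 0 < α) (h1 : α < 1) (n : ℕ) :
    2 ≤ npq α (n + 1) := by
  obtain ⟨-, hpos, hlt⟩ := ncq_irrational_mem α hirr h0 h1 n
  have h : (1 : ℤ) < ⌈(ncq α n)⁻¹⌉ := Int.lt_ceil.2 (by
    simpa using (one_lt_inv₀ hpos).2 hlt)
  simp only [npq, Nat.add_sub_cancel]
  omega

theorem nqPrev_nonneg_and_lt (α : ℝ) (hirr : Irrational α) (h0 : 0 < α) (h1 : α < 1) (n : ℕ) :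
    0 ≤ nqPrev α n ∧ nqPrev α n < nq α n := by
  induction n with
  | zero => simp [nqPrev, nq]
  | succ n ih =>
    rw [nq_succ]
    have ha := two_le_npq_succ α hirr h0 h1 n
    rw [show nqPrev α (n + 1) = nq α n from rfl]
    constructor <;> nlinarith

theorem drem_nonneg_and_lt_one (α β : ℝ) (hβ0 : 0 ≤ β) (hβ1 : β < 1) (n : ℕ) :
    0 ≤ drem α β n ∧ drem α β n < 1 := by
  cases n with
  | zero => exact ⟨hβ0, hβ1⟩
  | succ n => exact ⟨Int.fract_nonneg _, Int.fract_lt_one _⟩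

theorem drem_div_ncq (α β : ℝ) (n : ℕ) :
    drem α β n / ncq α n = db α β (n + 1) + drem α β (n + 1) :=
  (Int.floor_add_fract _).symm

theorem db_succ_nonneg (α β : ℝ) (hirr : Irrational α) (h0 : 0 < α) (h1 : α < 1)
    (hβ0 : 0 ≤ β) (hβ1 : β < 1) (n : ℕ) : 0 ≤ db α β (n + 1) :=
  Int.floor_nonneg.2 (div_nonneg (drem_nonneg_and_lt_one α β hβ0 hβ1 n).1
    (ncq_irrational_mem α hirr h0 h1 n).2.1.le)

theorem db_add_drem_lt (α β : ℝ) (hirr : Irrational α) (h0 : 0 < α) (h1 : α < 1)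
    (hβ0 : 0 ≤ β) (hβ1 : β < 1) (n : ℕ) :
    (db α β (n + 1) : ℝ) + drem α β (n + 1) < npq α (n + 1) - ncq α (n + 1) := by
  have h := (div_lt_div_iff_of_pos_right (ncq_irrational_mem α hirr h0 h1 n).2.1).2
    (drem_nonneg_and_lt_one α β hβ0 hβ1 n).2
  rw [drem_div_ncq, one_div] at h
  rw [ncq_succ]
  linarith

theorem db_add_drem_lt_sub_one (α β : ℝ) (hirr : Irrational α) (h0 : 0 < α) (h1 : α < 1)
    {n : ℕ} (hn : drem α β n < 1 - ncq α n) :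
    (db α β (n + 1) : ℝ) + drem α β (n + 1) < npq α (n + 1) - 1 - ncq α (n + 1) := by
  have hpos := (ncq_irrational_mem α hirr h0 h1 n).2.1
  have h := (div_lt_div_iff_of_pos_right hpos).2 hn
  rw [drem_div_ncq, sub_div, div_self hpos.ne', one_div] at h
  rw [ncq_succ]
  linarith

theorem db_succ_le (α β : ℝ) (hirr : Irrational α) (h0 : 0 < α) (h1 : α < 1)
    (hβ0 : 0 ≤ β) (hβ1 : β < 1) (n : ℕ) : db α β (n + 1) ≤ npq α (n + 1) - 1 := by
  have h := db_add_drem_lt α β hirr h0 h1 hβ0 hβ1 n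
  have h' := (drem_nonneg_and_lt_one α β hβ0 hβ1 (n + 1)).1
  have h'' := (ncq_irrational_mem α hirr h0 h1 (n + 1)).2.1
  have : (db α β (n + 1) : ℝ) < npq α (n + 1) := by linarith
  have : db α β (n + 1) < npq α (n + 1) := by exact_mod_cast this
  omega

theorem HasMaximalTail.drem_lt {α β : ℝ} (hirr : Irrational α) (h0 : 0 < α) (h1 : α < 1)
    (hβ0 : 0 ≤ β) (hβ1 : β < 1) {n : ℕ} (h : HasMaximalTail α β n) :
    drem α β n < 1 - ncq α n := by
  induction n with
  | zero => exact absurd h (not_hasMaximalTail_zero α β)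
  | succ n ih =>
    rcases (hasMaximalTail_succ α β n).1 h with hb | ⟨hb, ht⟩
    · have := db_add_drem_lt α β hirr h0 h1 hβ0 hβ1 n
      rw [hb] at this
      push_cast at this
      linarith
    · have := db_add_drem_lt_sub_one α β hirr h0 h1 (ih ht)
      rw [hb] at this
      push_cast at this
      linarith

theorem HasMaximalTail.db_succ_le {α β : ℝ} (hirr : Irrational α) (h0 : 0 < α) (h1 : α < 1)
    (hβ0 : 0 ≤ β) (hβ1 : β < 1) {n : ℕ} (h : HasMaximalTail α β n) :
    db α β (n + 1) ≤ npq α (n + 1) - 2 := by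
  have h' := db_add_drem_lt_sub_one α β hirr h0 h1 (h.drem_lt hirr h0 h1 hβ0 hβ1)
  have hd := (drem_nonneg_and_lt_one α β hβ0 hβ1 (n + 1)).1
  have hc := (ncq_irrational_mem α hirr h0 h1 (n + 1)).2.1
  have : (db α β (n + 1) : ℝ) < npq α (n + 1) - 1 := by linarith
  have : db α β (n + 1) < npq α (n + 1) - 1 := by exact_mod_cast this
  omega

theorem Qn_succ (α β : ℝ) (n : ℕ) :
    Qn α β (n + 1) = Qn α β n + db α β (n + 1) * nq α n := by
  simp [Qn, Finset.sum_Icc_succ_top]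

theorem Qn_nonneg (α β : ℝ) (hirr : Irrational α) (h0 : 0 < α) (h1 : α < 1)
    (hβ0 : 0 ≤ β) (hβ1 : β < 1) (n : ℕ) : 0 ≤ Qn α β n := by
  induction n with
  | zero => simp [Qn]
  | succ n ih =>
    have hq := nqPrev_nonneg_and_lt α hirr h0 h1 n
    rw [Qn_succ]
    exact add_nonneg ih (mul_nonneg (db_succ_nonneg α β hirr h0 h1 hβ0 hβ1 n)
      (hq.1.trans hq.2.le))

theorem Qn_bounds (α β : ℝ) (hirr : Irrational α) (h0 : 0 < α) (h1 : α < 1)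
    (hβ0 : 0 ≤ β) (hβ1 : β < 1) (n : ℕ) :
    Qn α β n < nq α n ∧
      (nq α n - nqPrev α n ≤ Qn α β n ↔ HasMaximalTail α β n) := by
  induction n with
  | zero => simp [Qn, nq, nqPrev, not_hasMaximalTail_zero]
  | succ n ih =>
    obtain ⟨hlt, hiff⟩ := ih
    have hQ := Qn_nonneg α β hirr h0 h1 hβ0 hβ1 n
    obtain ⟨hp, hpq⟩ := nqPrev_nonneg_and_lt α hirr h0 h1 n
    have hle := db_succ_le α β hirr h0 h1 hβ0 hβ1 n
    rw [Qn_succ, nq_succ, hasMaximalTail_succ, ← hiff, nqPrev]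
    rcases hle.eq_or_lt with hb | hb
    · have hnot : ¬ nq α n - nqPrev α n ≤ Qn α β n := fun h => by
        have := (hiff.1 h).db_succ_le hirr h0 h1 hβ0 hβ1
        omega
      rw [hb]
      exact ⟨by linarith, iff_of_true (by linarith) (Or.inl rfl)⟩
    · obtain hb2 | hb2 := (show db α β (n + 1) ≤ npq α (n + 1) - 2 by omega).eq_or_lt
      · rw [hb2]
        refine ⟨by linarith, fun h => Or.inr ⟨rfl, by linarith⟩, ?_⟩
        rintro (h | ⟨-, h⟩)
        · omega
        · linarith
      · have hmul := mul_le_mul_of_nonneg_right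
          (show db α β (n + 1) ≤ npq α (n + 1) - 3 by omega) (hp.trans hpq.le)
        refine ⟨by linarith, iff_of_false (by linarith) ?_⟩
        rintro (h | ⟨h, -⟩) <;> omega

/-- For irrational `0 < α < 1`, `0 ≤ β < 1` with Davenport coefficients `b`,
and `n ≥ 1`: `Q_n ≥ q_n − q_{n−1}` iff there is `1 ≤ m ≤ n` with
`(b_m, …, b_n) = (a_m − 1, a_{m+1} − 2, …, a_n − 2)`. -/
theorem stmt7 (α : ℝ) (hirr : Irrational α) (h0 : 0 < α) (h1 : α < 1)
    (β : ℝ) (hβ0 : 0 ≤ β) (hβ1 : β < 1) (n : ℕ) (hn : 1 ≤ n) :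
    nq α n - nq α (n - 1) ≤ Qn α β n ↔
      ∃ m : ℕ, 1 ≤ m ∧ m ≤ n ∧ db α β m = npq α m - 1 ∧
        ∀ k : ℕ, m < k → k ≤ n → db α β k = npq α k - 2 := by
  obtain ⟨k, rfl⟩ := Nat.exists_eq_add_of_le' hn
  exact (Qn_bounds α β hirr h0 h1 hβ0 hβ1 (k + 1)).2
end

section
/- Let α be irrational with 0 < α < 1. Let q ≥ 1 be an integer with Ostrowski expansion q = Σ_{k=1}^n c_k q_{k−1} (so c_n ≥ 1, 0 ≤ c_k ≤ a_k − 1, and no block (c_i, …, c_j) with i < j equals (a_i − 1, a_{i+1} − 2, …, a_{j−1} − 2, a_j − 1)), and set p = Σ_{k=1}^n c_k p_{k−1}. Then 0 < qα − p < 1 and the Davenport coefficients of qα − p are c₁, c₂, …, c_n, 0, 0, 0, …. -/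
open Filter Finset

theorem ncq_irrational_and_mem_Ioo {α : ℝ} (hirr : Irrational α) (h0 : 0 < α) (h1 : α < 1)
    (i : ℕ) : Irrational (ncq α i) ∧ 0 < ncq α i ∧ ncq α i < 1 := by
  induction i with
  | zero => exact ⟨hirr, h0, h1⟩
  | succ i ih =>
    have hinv : Irrational (ncq α i)⁻¹ := ih.1.inv
    have hsucc : ncq α (i + 1) = (⌈(ncq α i)⁻¹⌉ : ℝ) - (ncq α i)⁻¹ := rfl
    have hne : (ncq α i)⁻¹ ≠ (⌈(ncq α i)⁻¹⌉ : ℝ) := hinv.ne_int _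
    have hlt := lt_of_le_of_ne (Int.le_ceil (ncq α i)⁻¹) hne
    have hlt' := Int.ceil_lt_add_one (ncq α i)⁻¹
    rw [hsucc]
    exact ⟨hinv.intCast_sub _, by linarith, by linarith⟩

theorem ncq_mul_npq {α : ℝ} {i : ℕ} (h : 0 < ncq α i) :
    ncq α i * npq α (i + 1) = 1 + ncq α i * ncq α (i + 1) := by
  have hsucc : ncq α (i + 1) = (npq α (i + 1) : ℝ) - (ncq α i)⁻¹ := rfl
  rw [hsucc, mul_sub, mul_inv_cancel₀ h.ne']
  ring

theorem nq_mul_sub_np {α : ℝ} (hpos : ∀ i, 0 < ncq α i) (k : ℕ) :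
    nq α k * α - np α k = Dk α (k + 1) := by
  induction k using Nat.twoStepInduction with
  | zero => simp [nq, np, Dk, ncq]
  | one =>
    have h := ncq_mul_npq (hpos 0)
    simp only [zero_add] at h
    have hα : ncq α 0 = α := rfl
    simp only [nq, np, Dk, Finset.prod_range_succ, Finset.prod_range_zero, one_mul, Int.cast_one]
    rw [hα] at h ⊢
    linarith
  | more k ih ih' =>
    have h := ncq_mul_npq (hpos (k + 1))
    simp only [nq, np, Int.cast_sub, Int.cast_mul]
    simp only [Dk, Finset.prod_range_succ] at ih ih' ⊢
    linear_combination (npq α (k + 2) : ℝ) * ih' - ih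
      + (∏ j ∈ Finset.range k, ncq α j) * ncq α k * h

/-- The value `α_{i+1}(c_{i+1} + α_{i+2}(c_{i+2} + ⋯))` of a Davenport expansion of length `m`
starting after position `i`. -/
noncomputable def davenportTail (α : ℝ) (c : ℕ → ℤ) : ℕ → ℕ → ℝ
  | 0, _ => 0
  | m + 1, i => ncq α i * (c (i + 1) + davenportTail α c m (i + 1))

theorem Dk_mul_davenportTail (α : ℝ) (c : ℕ → ℤ) (m i : ℕ) :
    Dk α i * davenportTail α c m i
      = ∑ k ∈ Finset.range m, c (i + k + 1) * Dk α (i + k + 1) := by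
  induction m generalizing i with
  | zero => simp [davenportTail]
  | succ m ih =>
    have hD : Dk α (i + 1) = Dk α i * ncq α i := Finset.prod_range_succ _ _
    have hsum : ∑ k ∈ Finset.range m, (c (i + (k + 1) + 1) : ℝ) * Dk α (i + (k + 1) + 1)
        = Dk α (i + 1) * davenportTail α c m (i + 1) := by
      rw [ih]
      refine Finset.sum_congr rfl fun k _ => ?_
      rw [show i + (k + 1) + 1 = i + 1 + k + 1 by ring]
    rw [Finset.sum_range_succ', hsum, davenportTail, add_zero, hD]
    ring

theorem davenportTail_nonneg {α : ℝ} {c : ℕ → ℤ} (hpos : ∀ i, 0 < ncq α i) (m i : ℕ)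
    (hc : ∀ k, i < k → k ≤ i + m → 0 ≤ c k) : 0 ≤ davenportTail α c m i := by
  induction m generalizing i with
  | zero => exact le_rfl
  | succ m ih =>
    have hc' : (0 : ℝ) ≤ c (i + 1) := by exact_mod_cast hc (i + 1) (by omega) (by omega)
    have htail := ih (i + 1) fun k hk hk' => hc k (by omega) (by omega)
    exact mul_nonneg (hpos i).le (add_nonneg hc' htail)

/-- Ostrowski admissible digits give a Davenport expansion with value below `1`, and even below
`1 - α_{i+1}` if they do not begin with a block `a - 2, …, a - 2, a - 1`. -/
theorem davenportTail_lt {α : ℝ} {c : ℕ → ℤ} (hpos : ∀ i, 0 < ncq α i)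
    (hlt : ∀ i, ncq α i < 1) (m i : ℕ)
    (hc : ∀ k, i < k → k ≤ i + m → c k ≤ npq α k - 1)
    (hblock : ∀ l j, i < l → l < j → j ≤ i + m →
      ¬ (c l = npq α l - 1 ∧ (∀ k, l < k → k < j → c k = npq α k - 2) ∧ c j = npq α j - 1)) :
    davenportTail α c m i < 1 ∧
      ((∀ j, i < j → j ≤ i + m →
        ¬ ((∀ k, i < k → k < j → c k = npq α k - 2) ∧ c j = npq α j - 1)) →
      davenportTail α c m i < 1 - ncq α i) := by
  induction m generalizing i with
  | zero => exact ⟨by simp [davenportTail], fun _ => by simpa [davenportTail] using hlt i⟩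
  | succ m ih =>
    obtain ⟨ht, ht'⟩ := ih (i + 1) (fun k hk hk' => hc k (by omega) (by omega))
      (fun l j hl hlj hj => hblock l j (by omega) hlj (by omega))
    have hx := hpos i
    have hy := hlt (i + 1)
    have hrec := ncq_mul_npq hx
    have hle := hc (i + 1) (by omega) (by omega)
    rw [davenportTail]
    set t := davenportTail α c m (i + 1)
    set x := ncq α i
    set y := ncq α (i + 1)
    have hmul : ∀ s, c (i + 1) + t < s → x * (c (i + 1) + t) < x * s := fun s hs =>
      mul_lt_mul_of_pos_left hs hx
    have hxy : x * y < x := by nlinarith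
    constructor
    · rcases hle.eq_or_lt with heq | hlt'
      · have htail := ht' fun j hj hj' hjb =>
          hblock (i + 1) j (by omega) hj (by omega) ⟨heq, hjb⟩
        have hcast : (c (i + 1) : ℝ) = npq α (i + 1) - 1 := by exact_mod_cast heq
        have := hmul (npq α (i + 1) - y) (by linarith)
        linarith
      · have hcast : (c (i + 1) : ℝ) ≤ npq α (i + 1) - 2 := by
          exact_mod_cast (by omega : c (i + 1) ≤ npq α (i + 1) - 2)
        have := hmul (npq α (i + 1) - 1) (by linarith)
        linarith
    · intro hstart
      have hne : c (i + 1) ≠ npq α (i + 1) - 1 := fun h =>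
        hstart (i + 1) (by omega) (by omega) ⟨fun k hk hk' => by omega, h⟩
      by_cases heq : c (i + 1) = npq α (i + 1) - 2
      · have htail := ht' fun j hj hj' hjb =>
          hstart j (by omega) (by omega) ⟨fun k hk hk' => by
            rcases (Nat.succ_le_of_lt hk).eq_or_lt with h | h
            · rw [← h]; exact heq
            · exact hjb.1 k h hk', hjb.2⟩
        have hcast : (c (i + 1) : ℝ) = npq α (i + 1) - 2 := by exact_mod_cast heq
        have := hmul (npq α (i + 1) - 1 - y) (by linarith)
        linarith
      · have hcast : (c (i + 1) : ℝ) ≤ npq α (i + 1) - 3 := by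
          exact_mod_cast (by omega : c (i + 1) ≤ npq α (i + 1) - 3)
        have := hmul (npq α (i + 1) - 2) (by linarith)
        linarith

theorem drem_davenportTail {α : ℝ} {c : ℕ → ℤ} {n : ℕ} (hpos : ∀ i, 0 < ncq α i)
    (hmem : ∀ i, davenportTail α c (n - i) i ∈ Set.Ico (0 : ℝ) 1) (i : ℕ) :
    drem α (davenportTail α c n 0) i = davenportTail α c (n - i) i := by
  induction i with
  | zero => rfl
  | succ i ih =>
    rw [drem, ih]
    rcases lt_or_ge i n with h | h
    · rw [show n - i = n - (i + 1) + 1 by omega, davenportTail,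
        mul_div_cancel_left₀ _ (hpos i).ne', Int.fract_intCast_add, Int.fract_eq_self]
      exact hmem (i + 1)
    · rw [show n - i = 0 by omega, show n - (i + 1) = 0 by omega]
      simp [davenportTail]

/-- Let `q ≥ 1` have Ostrowski expansion `q = Σ_{k=1}^n c_k q_{k−1}`
(with `c_n ≥ 1`, `0 ≤ c_k ≤ a_k − 1`, and no forbidden block), and set
`p = Σ_{k=1}^n c_k p_{k−1}`. Then `0 < qα − p < 1` and the Davenport coefficients of
`qα − p` are `c₁, …, c_n, 0, 0, …`. -/
theorem stmt9 (α : ℝ) (hirr : Irrational α) (h0 : 0 < α) (h1 : α < 1)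
    (n : ℕ) (hn : 1 ≤ n) (c : ℕ → ℤ) (q p : ℤ)
    (hq : q = ∑ k ∈ Finset.Icc 1 n, c k * nq α (k - 1))
    (hq1 : 1 ≤ q)
    (hcn : 1 ≤ c n)
    (hc : ∀ k : ℕ, 1 ≤ k → k ≤ n → 0 ≤ c k ∧ c k ≤ npq α k - 1)
    (hblock : ∀ i j : ℕ, 1 ≤ i → i < j → j ≤ n →
      ¬ (c i = npq α i - 1 ∧ (∀ k : ℕ, i < k → k < j → c k = npq α k - 2) ∧
          c j = npq α j - 1))
    (hp : p = ∑ k ∈ Finset.Icc 1 n, c k * np α (k - 1)) :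
    0 < q * α - p ∧ q * α - p < 1 ∧
      (∀ i : ℕ, 1 ≤ i → i ≤ n → db α (q * α - p) i = c i) ∧
      (∀ i : ℕ, n < i → db α (q * α - p) i = 0) := by
  have hpos : ∀ i, 0 < ncq α i := fun i => (ncq_irrational_and_mem_Ioo hirr h0 h1 i).2.1
  have hlt : ∀ i, ncq α i < 1 := fun i => (ncq_irrational_and_mem_Ioo hirr h0 h1 i).2.2
  have hD : ∀ k, 0 < Dk α k := fun k => Finset.prod_pos fun j _ => hpos j
  have hsum : q * α - p = ∑ k ∈ Finset.Icc 1 n, c k * Dk α k := by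
    rw [hq, hp]
    push_cast
    rw [Finset.sum_mul, ← Finset.sum_sub_distrib]
    refine Finset.sum_congr rfl fun k hk => ?_
    have h := nq_mul_sub_np hpos (k - 1)
    rw [Nat.sub_add_cancel (Finset.mem_Icc.mp hk).1] at h
    rw [← h]
    ring
  have htail : q * α - p = davenportTail α c n 0 := by
    have h := Dk_mul_davenportTail α c n 0
    rw [show Dk α 0 = 1 from Finset.prod_range_zero _, one_mul] at h
    simp only [zero_add] at h
    rw [hsum, h, Finset.range_eq_Ico,
      Finset.sum_Ico_add' (fun k => (c k : ℝ) * Dk α k) 0 n 1]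
    rfl
  have hmem : ∀ i, davenportTail α c (n - i) i ∈ Set.Ico (0 : ℝ) 1 := by
    intro i
    rcases lt_or_ge i n with h | h
    · exact ⟨davenportTail_nonneg hpos _ _ fun k hk hk' => (hc k (by omega) (by omega)).1,
        (davenportTail_lt hpos hlt _ _ (fun k hk hk' => (hc k (by omega) (by omega)).2)
          fun l j hl hlj hj => hblock l j (by omega) hlj (by omega)).1⟩
    · simp [show n - i = 0 by omega, davenportTail]
  refine ⟨?_, ?_, fun i hi hin => ?_, fun i hi => ?_⟩
  · rw [hsum]
    have hcn' : (0 : ℝ) < c n := by exact_mod_cast hcn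
    refine Finset.sum_pos' (fun k hk => ?_) ⟨n, by simp [hn], mul_pos hcn' (hD n)⟩
    obtain ⟨hk, hk'⟩ := Finset.mem_Icc.mp hk
    exact mul_nonneg (by exact_mod_cast (hc k hk hk').1) (hD k).le
  · rw [htail]
    exact (hmem 0).2
  · obtain ⟨j, rfl⟩ := Nat.exists_eq_add_of_le' hi
    rw [htail, db, Nat.add_sub_cancel, drem_davenportTail hpos hmem,
      show n - j = n - (j + 1) + 1 by omega, davenportTail,
      mul_div_cancel_left₀ _ (hpos j).ne', Int.floor_intCast_add,
      Int.floor_eq_zero_iff.mpr (hmem (j + 1)), add_zero]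
  · rw [htail, db, drem_davenportTail hpos hmem, show n - (i - 1) = 0 by omega]
    simp [davenportTail]
end

section
/- Let α be irrational with 0 < α < 1 whose negative continued fraction partial quotients satisfy a_i ≤ M for all i and contain no block of N consecutive terms equal to 2; set R = N/(N+1) and let L be the smallest positive integer with R^L ≤ (1 − R)(1 − R²)/(M^N(M² − 1)). Let r and s be positive integers with r ≥ sL. Then for all positive integers u, v, n, m with u + r < v and n < m ≤ n + s + N, one has q_u D_{v−1} < q_{n−1} D_m (1 − α_{m+1}). -/
open Filter Finset

theorem ncq_irrational (α : ℝ) (hirr : Irrational α) (i : ℕ) : Irrational (ncq α i) := by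
  induction i with
  | zero => exact hirr
  | succ i ih => exact ih.inv.intCast_sub _

theorem ncq_mem_Ioo (α : ℝ) (hirr : Irrational α) (h0 : 0 < α) (h1 : α < 1) (i : ℕ) :
    0 < ncq α i ∧ ncq α i < 1 := by
  cases i with
  | zero => exact ⟨h0, h1⟩
  | succ i =>
    have hle := Int.le_ceil (ncq α i)⁻¹
    have hlt := Int.ceil_lt_add_one (ncq α i)⁻¹
    have hne := (ncq_irrational α hirr i).inv.ne_int ⌈(ncq α i)⁻¹⌉
    have := lt_of_le_of_ne hle hne
    simp only [ncq]
    constructor <;> linarith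

theorem ncq_mul_npq_sub (α : ℝ) (hirr : Irrational α) (h0 : 0 < α) (h1 : α < 1) (i : ℕ) :
    ncq α i * ((npq α (i + 1) : ℝ) - ncq α (i + 1)) = 1 := by
  have h := (ncq_mem_Ioo α hirr h0 h1 i).1
  simp only [npq, ncq, Nat.add_sub_cancel]
  rw [sub_sub_cancel, mul_inv_cancel₀ h.ne']

theorem two_le_npq (α : ℝ) (hirr : Irrational α) (h0 : 0 < α) (h1 : α < 1) (i : ℕ) :
    2 ≤ npq α (i + 1) := by
  obtain ⟨h, h'⟩ := ncq_mem_Ioo α hirr h0 h1 i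
  have : (1 : ℝ) < (ncq α i)⁻¹ := (one_lt_inv₀ h).2 h'
  have : (1 : ℤ) < ⌈(ncq α i)⁻¹⌉ := Int.lt_ceil.2 (by simpa using this)
  exact this

/-- A partial quotient other than `2` among the next `k + 1` bounds the complete quotient. -/
theorem ncq_mul_lt_of_exists_ne_two (α : ℝ) (hirr : Irrational α) (h0 : 0 < α) (h1 : α < 1)
    (k i : ℕ) (h : ∃ l ≤ k, npq α (i + l + 1) ≠ 2) :
    ncq α i * ((k : ℝ) + 2) < k + 1 := by
  induction k generalizing i with
  | zero =>
    obtain ⟨l, hl, hne⟩ := h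
    obtain rfl : l = 0 := by omega
    have h2 := two_le_npq α hirr h0 h1 i
    have h3 : (3 : ℝ) ≤ npq α (i + 1) := by
      have : 3 ≤ npq α (i + 1) := by simp only [add_zero] at hne; omega
      exact_mod_cast this
    have hp := (ncq_mem_Ioo α hirr h0 h1 i).1
    have hq := (ncq_mem_Ioo α hirr h0 h1 (i + 1)).2
    have hm := ncq_mul_npq_sub α hirr h0 h1 i
    push_cast
    nlinarith
  | succ k ih =>
    have hp := ncq_mem_Ioo α hirr h0 h1 i
    have hq := (ncq_mem_Ioo α hirr h0 h1 (i + 1)).2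
    have hm := ncq_mul_npq_sub α hirr h0 h1 i
    have h2 := two_le_npq α hirr h0 h1 i
    have hk : (0 : ℝ) ≤ k := k.cast_nonneg
    push_cast
    by_cases he : npq α (i + 1) = 2
    · obtain ⟨l, hl, hne⟩ := h
      have hi := ih (i + 1) (by
        cases l with
        | zero => exact absurd he hne
        | succ l => exact ⟨l, by omega, by rwa [show i + 1 + l + 1 = i + (l + 1) + 1 by ring]⟩)
      rw [he] at hm
      push_cast at hm
      have := mul_lt_mul_of_pos_left hi hp.1
      nlinarith
    · have h3 : (3 : ℝ) ≤ npq α (i + 1) := by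
        have : 3 ≤ npq α (i + 1) := by omega
        exact_mod_cast this
      have : ncq α i * 2 < 1 := by nlinarith
      nlinarith

theorem nq_pos_and_le_succ (α : ℝ) (hirr : Irrational α) (h0 : 0 < α) (h1 : α < 1) (n : ℕ) :
    0 < nq α n ∧ nq α n ≤ nq α (n + 1) := by
  induction n with
  | zero =>
    have := two_le_npq α hirr h0 h1 0
    simp only [nq, zero_add] at *
    omega
  | succ n ih =>
    have := two_le_npq α hirr h0 h1 (n + 1)
    refine ⟨by omega, ?_⟩
    simp only [nq]
    nlinarith

theorem nq_succ_le (α : ℝ) (hirr : Irrational α) (h0 : 0 < α) (h1 : α < 1) (n : ℕ) :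
    nq α (n + 1) ≤ npq α (n + 1) * nq α n := by
  cases n with
  | zero => simp [nq]
  | succ n =>
    have := (nq_pos_and_le_succ α hirr h0 h1 n).1
    simp only [nq]
    linarith

/-- The ratio `q_n / q_{n+1}` is controlled by the length of the run of `2`s ending at `n + 1`. -/
theorem exists_run_nq_mul_le (α : ℝ) (hirr : Irrational α) (h0 : 0 < α) (h1 : α < 1) (n : ℕ) :
    ∃ k ≤ n, ((k : ℤ) + 2) * nq α n ≤ (k + 1) * nq α (n + 1) ∧
      ∀ j, n + 1 < j + k → j ≤ n + 1 → npq α j = 2 := by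
  induction n with
  | zero =>
    refine ⟨0, le_rfl, ?_, fun j _ _ => by omega⟩
    have := two_le_npq α hirr h0 h1 0
    simp only [nq, zero_add] at *
    push_cast
    omega
  | succ n ih =>
    have hq := nq_pos_and_le_succ α hirr h0 h1 n
    have h2 : 2 ≤ npq α (n + 2) := two_le_npq α hirr h0 h1 (n + 1)
    by_cases he : npq α (n + 2) = 2
    · obtain ⟨k, hk, hle, hrun⟩ := ih
      refine ⟨k + 1, by omega, ?_, fun j hj hj' => ?_⟩
      · simp only [nq, he]
        push_cast
        linarith
      · rcases Nat.lt_or_ge (n + 1) j with h | h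
        · rwa [show j = n + 2 by omega]
        · exact hrun j (by omega) h
    · refine ⟨0, by omega, ?_, fun j _ _ => by omega⟩
      have : 3 ≤ npq α (n + 2) := by omega
      simp only [nq]
      push_cast
      nlinarith

theorem Dk_succ (α : ℝ) (n : ℕ) : Dk α (n + 1) = Dk α n * ncq α n :=
  Finset.prod_range_succ _ _

theorem Dk_pos (α : ℝ) (hirr : Irrational α) (h0 : 0 < α) (h1 : α < 1) (n : ℕ) : 0 < Dk α n :=
  Finset.prod_pos fun i _ => (ncq_mem_Ioo α hirr h0 h1 i).1

theorem Dk_mul_nq_sub (α : ℝ) (hirr : Irrational α) (h0 : 0 < α) (h1 : α < 1) (n : ℕ) :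
    Dk α (n + 1) * ((nq α (n + 1) : ℝ) - nq α n * ncq α (n + 1)) = 1 := by
  induction n with
  | zero => simpa [Dk, nq] using ncq_mul_npq_sub α hirr h0 h1 0
  | succ n ih =>
    have hm := ncq_mul_npq_sub α hirr h0 h1 (n + 1)
    rw [Dk_succ, ← ih]
    simp only [nq]
    push_cast
    linear_combination (Dk α (n + 1) * nq α (n + 1)) * hm

theorem Dk_add_le (α R : ℝ) (hirr : Irrational α) (h0 : 0 < α) (h1 : α < 1)
    (hR : ∀ i, ncq α i ≤ R) (n j : ℕ) : Dk α (n + j) ≤ Dk α n * R ^ j := by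
  induction j with
  | zero => simp
  | succ j ih =>
    rw [← add_assoc, Dk_succ, pow_succ, ← mul_assoc]
    exact mul_le_mul ih (hR _) (ncq_mem_Ioo α hirr h0 h1 _).1.le
      ((Dk_pos α hirr h0 h1 _).le.trans ih)

theorem le_Dk_add_mul_pow (α c : ℝ) (hirr : Irrational α) (h0 : 0 < α) (h1 : α < 1)
    (hc : 0 ≤ c) (h : ∀ i, 1 ≤ ncq α i * c) (n j : ℕ) : Dk α n ≤ Dk α (n + j) * c ^ j := by
  induction j with
  | zero => simp
  | succ j ih =>
    have hD := (Dk_pos α hirr h0 h1 (n + j)).le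
    calc Dk α n ≤ Dk α (n + j) * c ^ j := ih
      _ ≤ Dk α (n + j) * c ^ j * (ncq α (n + j) * c) :=
        le_mul_of_one_le_right (mul_nonneg hD (pow_nonneg hc j)) (h _)
      _ = Dk α (n + (j + 1)) * c ^ (j + 1) := by rw [← add_assoc, Dk_succ]; ring

/-- An exponent inequality: `x ^ L` small enough forces `x ^ (s * L)` to beat `M ^ (s + N - 1)`. -/
theorem pow_mul_le_of_pow_le (x c M : ℝ) (L N s j : ℕ) (hx : 0 ≤ x) (hc : c ≤ 1)
    (hM : 2 ≤ M) (hN : 1 ≤ N) (hs : 0 < s) (hj : j + 1 ≤ s + N)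
    (h : x ^ L ≤ c / (M ^ N * (M ^ 2 - 1))) :
    x ^ (s * L) * (M ^ j * (M ^ 2 - 1)) ≤ c := by
  obtain ⟨t, rfl⟩ : ∃ t, s = t + 1 := ⟨s - 1, by omega⟩
  have hM2 : 1 ≤ M ^ 2 - 1 := by nlinarith
  have hMN : M ≤ M ^ N := le_self_pow₀ (by linarith) (by omega)
  have hpos : 0 < M ^ N * (M ^ 2 - 1) := by positivity
  rw [le_div_iff₀ hpos] at h
  have hxL : 0 ≤ x ^ L := pow_nonneg hx L
  have hxM : x ^ L * M ≤ 1 := by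
    have : x ^ L * M ≤ x ^ L * (M ^ N * (M ^ 2 - 1)) :=
      mul_le_mul_of_nonneg_left (by nlinarith) hxL
    linarith
  have hpow : M ^ j ≤ M ^ (t + N) := pow_le_pow_right₀ (by linarith) (by omega)
  calc x ^ ((t + 1) * L) * (M ^ j * (M ^ 2 - 1))
      ≤ x ^ ((t + 1) * L) * (M ^ (t + N) * (M ^ 2 - 1)) := by gcongr
    _ = (x ^ L * M) ^ t * (x ^ L * (M ^ N * (M ^ 2 - 1))) := by
      rw [mul_comm (t + 1) L, pow_mul]; ring
    _ ≤ 1 * (x ^ L * (M ^ N * (M ^ 2 - 1))) := by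
      have : (x ^ L * M) ^ t ≤ 1 := pow_le_one₀ (by positivity) hxM
      gcongr
    _ ≤ c := by linarith

/-- With `a_i ≤ M`, no block of `N` consecutive `2`'s, `R = N/(N+1)` and `L`
the smallest positive integer with `R^L ≤ (1−R)(1−R²)/(M^N(M²−1))`: if `r ≥ sL` (`r,s ≥ 1`),
then for all positive `u, v, n, m` with `u + r < v` and `n < m ≤ n + s + N`,
`q_u D_{v−1} < q_{n−1} D_m (1 − α_{m+1})`. -/
theorem stmt16 (α : ℝ) (hirr : Irrational α) (h0 : 0 < α) (h1 : α < 1)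
    (M N : ℕ) (hM0 : 0 < M) (hN0 : 1 ≤ N)
    (hM : ∀ i : ℕ, 1 ≤ i → npq α i ≤ (M : ℤ))
    (hN : ¬ ∃ i : ℕ, 1 ≤ i ∧ ∀ k : ℕ, i ≤ k → k < i + N → npq α k = 2)
    (R : ℝ) (hR : R = (N : ℝ) / ((N : ℝ) + 1))
    (L : ℕ)
    (hL : IsLeast {l : ℕ | 0 < l ∧
      R ^ l ≤ (1 - R) * (1 - R ^ 2) / ((M : ℝ) ^ N * ((M : ℝ) ^ 2 - 1))} L)
    (r s : ℕ) (hr : 0 < r) (hs : 0 < s) (hrs : s * L ≤ r) :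
    ∀ u v n m : ℕ, 0 < u → 0 < v → 0 < n → 0 < m →
      u + r < v → n < m → m ≤ n + s + N →
      (nq α u : ℝ) * Dk α (v - 1) <
        (nq α (n - 1) : ℝ) * Dk α m * (1 - ncq α m) := by
  intro u v n m hu _ hn _ huv hnm hmn
  obtain ⟨w, rfl⟩ : ∃ w, u = w + 1 := ⟨u - 1, by omega⟩
  obtain ⟨b, rfl⟩ : ∃ b, n = b + 1 := ⟨n - 1, by omega⟩
  obtain ⟨j, rfl⟩ : ∃ j, m = b + 2 + j := ⟨m - (b + 2), by omega⟩
  obtain ⟨i, hv, hi⟩ : ∃ i, v - 1 = w + 1 + i ∧ s * L ≤ i := ⟨v - 1 - (w + 1), by omega, by omega⟩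
  rw [hv, Nat.add_sub_cancel]
  have hN1 : (1 : ℝ) ≤ N := by exact_mod_cast hN0
  have hR0 : 0 < R := by rw [hR]; positivity
  have hR1 : R < 1 := by rw [hR, div_lt_one (by positivity)]; linarith
  have hαR : ∀ i, ncq α i < R := by
    intro i
    have h : ∃ l ≤ N - 1, npq α (i + l + 1) ≠ 2 := by
      by_contra! h
      refine hN ⟨i + 1, by omega, fun k hk hk' => ?_⟩
      have := h (k - (i + 1)) (by omega)
      rwa [show i + (k - (i + 1)) + 1 = k by omega] at this
    have := ncq_mul_lt_of_exists_ne_two α hirr h0 h1 (N - 1) i h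
    rw [Nat.cast_sub hN0] at this
    rw [hR, lt_div_iff₀ (by positivity)]
    push_cast at this
    linarith
  have hqpos : ∀ i, (0 : ℝ) < nq α i := fun i => by
    exact_mod_cast (nq_pos_and_le_succ α hirr h0 h1 i).1
  have hqR : ∀ i, (nq α i : ℝ) ≤ R * nq α (i + 1) := by
    intro i
    obtain ⟨k, hk, hle, hrun⟩ := exists_run_nq_mul_le α hirr h0 h1 i
    have hkN : k + 1 ≤ N := by
      by_contra! hlt
      exact hN ⟨i + 2 - N, by omega, fun l hl hl' => hrun l (by omega) (by omega)⟩
    have hle' : ((k : ℝ) + 2) * nq α i ≤ (k + 1) * nq α (i + 1) := by exact_mod_cast hle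
    have hkN' : (k : ℝ) + 1 ≤ N := by exact_mod_cast hkN
    have hmono : (nq α i : ℝ) ≤ nq α (i + 1) := by
      exact_mod_cast (nq_pos_and_le_succ α hirr h0 h1 i).2
    rw [hR, div_mul_eq_mul_div, le_div_iff₀ (by positivity)]
    nlinarith
  have hM2 : (2 : ℝ) ≤ M := by
    exact_mod_cast (two_le_npq α hirr h0 h1 0).trans (hM 1 le_rfl)
  have hMα : ∀ i, 1 ≤ ncq α i * M := by
    intro i
    have hm := ncq_mul_npq_sub α hirr h0 h1 i
    have hp := (ncq_mem_Ioo α hirr h0 h1 i).1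
    have hp' := (ncq_mem_Ioo α hirr h0 h1 (i + 1)).1
    have : (npq α (i + 1) : ℝ) ≤ M := by exact_mod_cast hM (i + 1) (by omega)
    nlinarith
  have hR2 : 0 < 1 - R ^ 2 := by nlinarith
  have hMsq : (0 : ℝ) < (M : ℝ) ^ 2 - 1 := by nlinarith
  -- upper bound for the left-hand side
  have hleft : (nq α (w + 1) : ℝ) * Dk α (w + 1 + i) * (1 - R ^ 2) ≤ R ^ (s * L) := by
    have hD := Dk_pos α hirr h0 h1 (w + 1)
    have hunit : Dk α (w + 1) * (nq α (w + 1) * (1 - R ^ 2)) ≤ 1 := by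
      refine (mul_le_mul_of_nonneg_left ?_ hD.le).trans (Dk_mul_nq_sub α hirr h0 h1 w).le
      have := mul_le_mul (hqR w) (hαR (w + 1)).le (ncq_mem_Ioo α hirr h0 h1 (w + 1)).1.le
        (mul_pos hR0 (hqpos _)).le
      linarith
    calc (nq α (w + 1) : ℝ) * Dk α (w + 1 + i) * (1 - R ^ 2)
        ≤ nq α (w + 1) * (Dk α (w + 1) * R ^ i) * (1 - R ^ 2) := by
          have := Dk_add_le α R hirr h0 h1 (fun i => (hαR i).le) (w + 1) i
          have := (hqpos (w + 1)).le
          gcongr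
      _ = Dk α (w + 1) * (nq α (w + 1) * (1 - R ^ 2)) * R ^ i := by ring
      _ ≤ 1 * R ^ i := by gcongr
      _ ≤ R ^ (s * L) := by
        rw [one_mul]; exact pow_le_pow_of_le_one hR0.le hR1.le hi
  -- lower bound for the right-hand side
  have hright : 1 ≤ (nq α b : ℝ) * Dk α (b + 2 + j) * ((M : ℝ) ^ j * ((M : ℝ) ^ 2 - 1)) := by
    have hD := Dk_pos α hirr h0 h1 (b + 1)
    have hle : (nq α (b + 1) : ℝ) ≤ M * nq α b := by
      have h : (nq α (b + 1) : ℝ) ≤ npq α (b + 1) * nq α b := by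
        exact_mod_cast nq_succ_le α hirr h0 h1 b
      have h' : (npq α (b + 1) : ℝ) ≤ M := by exact_mod_cast hM (b + 1) (by omega)
      exact h.trans (mul_le_mul_of_nonneg_right h' (hqpos b).le)
    have hM' : (M : ℝ) - ncq α (b + 1) ≤ ncq α (b + 1) * ((M : ℝ) ^ 2 - 1) := by
      nlinarith [hMα (b + 1)]
    calc 1 = Dk α (b + 1) * ((nq α (b + 1) : ℝ) - nq α b * ncq α (b + 1)) :=
          (Dk_mul_nq_sub α hirr h0 h1 b).symm
      _ ≤ Dk α (b + 1) * (nq α b * (M - ncq α (b + 1))) :=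
          mul_le_mul_of_nonneg_left (by linarith) hD.le
      _ ≤ Dk α (b + 1) * (nq α b * (ncq α (b + 1) * ((M : ℝ) ^ 2 - 1))) := by
          have := (hqpos b).le
          gcongr
      _ = nq α b * Dk α (b + 2) * ((M : ℝ) ^ 2 - 1) := by rw [Dk_succ α (b + 1)]; ring
      _ ≤ nq α b * (Dk α (b + 2 + j) * (M : ℝ) ^ j) * ((M : ℝ) ^ 2 - 1) := by
          have := le_Dk_add_mul_pow α M hirr h0 h1 (by positivity) hMα (b + 2) j
          have := (hqpos b).le
          gcongr
      _ = _ := by ring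
  have hexp := pow_mul_le_of_pow_le R ((1 - R) * (1 - R ^ 2)) M L N s j hR0.le (by nlinarith)
    hM2 hN0 hs (by omega) hL.1.2
  set K : ℝ := (M : ℝ) ^ j * ((M : ℝ) ^ 2 - 1) with hK
  have hKpos : 0 < K := by positivity
  refine lt_of_mul_lt_mul_right ?_ (mul_pos hKpos hR2).le
  calc (nq α (w + 1) : ℝ) * Dk α (w + 1 + i) * (K * (1 - R ^ 2))
      = (nq α (w + 1) : ℝ) * Dk α (w + 1 + i) * (1 - R ^ 2) * K := by ring
    _ ≤ R ^ (s * L) * K := by gcongr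
    _ ≤ (1 - R) * (1 - R ^ 2) := hexp
    _ < (1 - ncq α (b + 2 + j)) * (1 - R ^ 2) := by
      have := hαR (b + 2 + j)
      gcongr
    _ ≤ (nq α b * Dk α (b + 2 + j) * K) * ((1 - ncq α (b + 2 + j)) * (1 - R ^ 2)) :=
      le_mul_of_one_le_left
        (mul_nonneg (by linarith [hαR (b + 2 + j)]) hR2.le) hright
    _ = nq α b * Dk α (b + 2 + j) * (1 - ncq α (b + 2 + j)) * (K * (1 - R ^ 2)) := by ring
end
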